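/- Let W ⊆ ℝ^n be a compact set that is a finite union of convex polyhedra, where a convex polyhedron is an intersection of finitely many closed half-spaces {x ∈ ℝ^n : ⟨l, x⟩ ≤ c}. Let I be a nonempty finite index set, J a finite index set, and (a_i)_{i ∈ I}, (b_j)_{j ∈ J} families of points of ℝ^n. Then the set A := closure( ⋂_{i ∈ I} (int(W) − a_i) ∩ ⋂_{j ∈ J} ((ℝ^n \ W) − b_j) ) can be written as a finite (possibly empty) union of closed convex sets each having nonempty interior. -/

import Mathlib

open Pointwise RealInnerProductSpace

/-- A convex polyhedron in `ℝ^n`: an intersection of finitely many closed half-spaces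
`{x : ⟨l, x⟩ ≤ c}`. -/
def IsConvexPolyhedron {n : ℕ} (S : Set (EuclideanSpace ℝ (Fin n))) : Prop :=
  ∃ T : Finset (EuclideanSpace ℝ (Fin n) × ℝ),
    S = ⋂ p ∈ T, {x : EuclideanSpace ℝ (Fin n) | ⟪p.1, x⟫ ≤ p.2}

/-- Open sets containing a dense finite union of open convex sets. -/
def GoodSet {E : Type*} [NormedAddCommGroup E] [NormedSpace ℝ E] (S : Set E) : Prop :=
  IsOpen S ∧ ∃ F : Set (Set E), F.Finite ∧ (∀ O ∈ F, IsOpen O ∧ Convex ℝ O) ∧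
    ⋃₀ F ⊆ S ∧ S ⊆ closure (⋃₀ F)

section
variable {E : Type*} [NormedAddCommGroup E] [NormedSpace ℝ E]

theorem GoodSet.of_convex {S : Set E} (h : IsOpen S) (hc : Convex ℝ S) : GoodSet S :=
  ⟨h, {S}, Set.finite_singleton _, by simpa using ⟨h, hc⟩, by simp,
    by simpa using subset_closure⟩

theorem GoodSet.iUnion {ι : Type*} [Finite ι] {S : ι → Set E} (h : ∀ i, GoodSet (S i)) :
    GoodSet (⋃ i, S i) := by
  choose ho F hF hO h1 h2 using h
  refine ⟨isOpen_iUnion ho, ⋃ i, F i, Set.finite_iUnion hF, ?_, ?_, ?_⟩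
  · intro O hO'
    obtain ⟨i, hi⟩ := Set.mem_iUnion.1 hO'
    exact hO i O hi
  · rintro x ⟨O, hO', hx⟩
    obtain ⟨i, hi⟩ := Set.mem_iUnion.1 hO'
    exact Set.mem_iUnion.2 ⟨i, h1 i ⟨O, hi, hx⟩⟩
  · refine Set.iUnion_subset fun i => (h2 i).trans (closure_mono ?_)
    exact Set.sUnion_subset_sUnion (Set.subset_iUnion F i)

theorem GoodSet.inter {S T : Set E} (hS : GoodSet S) (hT : GoodSet T) : GoodSet (S ∩ T) := by
  obtain ⟨oS, F, hF, hFO, hF1, hF2⟩ := hS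
  obtain ⟨oT, G, hG, hGO, hG1, hG2⟩ := hT
  refine ⟨oS.inter oT, Set.image2 (· ∩ ·) F G, hF.image2 _ hG, ?_, ?_, ?_⟩
  · rintro _ ⟨O, hO, P, hP, rfl⟩
    exact ⟨(hFO O hO).1.inter (hGO P hP).1, (hFO O hO).2.inter (hGO P hP).2⟩
  · rintro x ⟨_, ⟨O, hO, P, hP, rfl⟩, hx⟩
    exact ⟨hF1 ⟨O, hO, hx.1⟩, hG1 ⟨P, hP, hx.2⟩⟩
  · rintro x ⟨hxS, hxT⟩
    rw [mem_closure_iff]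
    intro N hN hxN
    obtain ⟨y, ⟨hyN, hyT⟩, O, hO, hyO⟩ :=
      mem_closure_iff.1 (hF2 hxS) (N ∩ T) (hN.inter oT) ⟨hxN, hxT⟩
    obtain ⟨z, ⟨hzN, hzO⟩, P, hP, hzP⟩ :=
      mem_closure_iff.1 (hG2 hyT) (N ∩ O) (hN.inter (hFO O hO).1) ⟨hyN, hyO⟩
    exact ⟨z, hzN, O ∩ P, ⟨O, hO, P, hP, rfl⟩, hzO, hzP⟩

theorem GoodSet.biInter {ι : Type*} (s : Finset ι) {S : ι → Set E} (h : ∀ i, GoodSet (S i)) :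
    GoodSet (⋂ i ∈ s, S i) := by
  classical
  induction s using Finset.induction_on with
  | empty => simpa using GoodSet.of_convex (E := E) isOpen_univ convex_univ
  | insert i s _ ih =>
    rw [Finset.set_biInter_insert]
    exact (h i).inter ih

theorem GoodSet.iInter {ι : Type*} [Fintype ι] {S : ι → Set E} (h : ∀ i, GoodSet (S i)) :
    GoodSet (⋂ i, S i) := by
  simpa using GoodSet.biInter Finset.univ h

theorem GoodSet.translate {S : Set E} (h : GoodSet S) (v : E) :
    GoodSet ((fun w => w - v) '' S) := by
  obtain ⟨oS, F, hF, hFO, hF1, hF2⟩ := h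
  have ho : IsOpenMap (fun w : E => w - v) := (Homeomorph.subRight v).isOpenMap
  refine ⟨ho _ oS, (fun O => (fun w => w - v) '' O) '' F, hF.image _, ?_, ?_, ?_⟩
  · rintro _ ⟨O, hO, rfl⟩
    refine ⟨ho _ (hFO O hO).1, ?_⟩
    simpa only [sub_eq_add_neg, add_comm] using (hFO O hO).2.translate (-v)
  · rintro x ⟨_, ⟨O, hO, rfl⟩, ⟨y, hy, rfl⟩⟩
    exact ⟨y, hF1 ⟨O, hO, hy⟩, rfl⟩
  · rintro _ ⟨y, hy, rfl⟩
    have := image_closure_subset_closure_image (f := fun w : E => w - v) (s := ⋃₀ F)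
      (by fun_prop) ⟨y, hF2 hy, rfl⟩
    refine closure_mono ?_ this
    rintro _ ⟨z, ⟨O, hO, hz⟩, rfl⟩
    exact ⟨_, ⟨O, hO, rfl⟩, z, hz, rfl⟩

theorem goodSet_interior_iUnion [CompleteSpace E] {ι : Type*} [Finite ι] {Q : ι → Set E}
    (hc : ∀ i, IsClosed (Q i)) (hv : ∀ i, Convex ℝ (Q i)) : GoodSet (interior (⋃ i, Q i)) := by
  refine ⟨isOpen_interior, Set.range fun i => interior (Q i), Set.finite_range _, ?_, ?_, ?_⟩
  · rintro _ ⟨i, rfl⟩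
    exact ⟨isOpen_interior, (hv i).interior⟩
  · rintro x ⟨_, ⟨i, rfl⟩, hx⟩
    exact interior_mono (Set.subset_iUnion Q i) hx
  · have hd : Dense (⋂ i, (frontier (Q i))ᶜ) :=
      dense_iInter_of_isOpen (fun i => isClosed_frontier.isOpen_compl)
        (fun i => interior_eq_empty_iff_dense_compl.1 (interior_frontier (hc i)))
    refine (hd.open_subset_closure_inter isOpen_interior).trans (closure_mono ?_)
    rintro x ⟨hx, hx'⟩
    obtain ⟨i, hi⟩ := Set.mem_iUnion.1 (interior_subset hx)
    refine ⟨_, ⟨i, rfl⟩, ?_⟩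
    by_contra hn
    exact Set.mem_iInter.1 hx' i ⟨subset_closure hi, hn⟩

theorem GoodSet.conclusion {S : Set E} (h : GoodSet S) :
    ∃ (k : ℕ) (C : Fin k → Set E),
      (∀ m, IsClosed (C m) ∧ Convex ℝ (C m) ∧ (interior (C m)).Nonempty) ∧
      closure S = ⋃ m, C m := by
  obtain ⟨oS, F, hF, hFO, hF1, hF2⟩ := h
  have hG : {O | O ∈ F ∧ O.Nonempty}.Finite := hF.subset fun O hO => hO.1
  obtain ⟨k, f, hf⟩ := hG.fin_embedding
  have hm : ∀ m, f m ∈ F ∧ (f m).Nonempty := fun m => by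
    have : f m ∈ Set.range f := ⟨m, rfl⟩
    rwa [hf] at this
  refine ⟨k, fun m => closure (f m), fun m => ⟨isClosed_closure, (hFO _ (hm m).1).2.closure,
    (hm m).2.mono (interior_maximal subset_closure (hFO _ (hm m).1).1)⟩, ?_⟩
  rw [← closure_iUnion_of_finite]
  refine subset_antisymm (closure_minimal (hF2.trans (closure_mono ?_)) isClosed_closure)
    (closure_mono ?_)
  · rintro x ⟨O, hO, hx⟩
    have : O ∈ Set.range f := by
      rw [hf]
      exact ⟨hO, x, hx⟩
    obtain ⟨m, rfl⟩ := this
    exact Set.mem_iUnion.2 ⟨m, hx⟩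
  · exact Set.iUnion_subset fun m x hx => hF1 ⟨_, (hm m).1, hx⟩

end

theorem IsConvexPolyhedron.facts {n : ℕ} {S : Set (EuclideanSpace ℝ (Fin n))}
    (h : IsConvexPolyhedron S) : IsClosed S ∧ Convex ℝ S ∧ GoodSet Sᶜ := by
  obtain ⟨T, rfl⟩ := h
  refine ⟨?_, ?_, ?_⟩
  · exact isClosed_biInter fun p _ => isClosed_le (by fun_prop) (by fun_prop)
  · exact convex_iInter₂ fun p _ => convex_halfSpace_le (innerₛₗ ℝ p.1).isLinear p.2
  · have : (⋂ p ∈ T, {x : EuclideanSpace ℝ (Fin n) | ⟪p.1, x⟫ ≤ p.2})ᶜ =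
        ⋃ p : T, {x : EuclideanSpace ℝ (Fin n) | p.1.2 < ⟪p.1.1, x⟫} := by
      ext x
      simp
    rw [this]
    exact GoodSet.iUnion fun p => GoodSet.of_convex (isOpen_lt (by fun_prop) (by fun_prop))
      (convex_halfSpace_gt (innerₛₗ ℝ p.1.1).isLinear p.1.2)

/-- **Lemma (sectors of acceptance domains).**  If `W ⊆ ℝ^n` is compact and a finite union of
convex polyhedra, then for any families of translation vectors `(a_i)_{i∈I}` (`I` finite and
nonempty) and `(b_j)_{j∈J}` (`J` finite), the set
`A = closure(⋂_i (int W − a_i) ∩ ⋂_j (W^c − b_j))` is a finite (possibly empty) union of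
closed convex sets with nonempty interior. -/
theorem acceptance_domain_sectors {n : ℕ} (W : Set (EuclideanSpace ℝ (Fin n)))
    (hWcomp : IsCompact W)
    (hWpoly : ∃ (k : ℕ) (Q : Fin k → Set (EuclideanSpace ℝ (Fin n))),
      (∀ m, IsConvexPolyhedron (Q m)) ∧ W = ⋃ m, Q m)
    {I J : Type*} [Fintype I] [Nonempty I] [Fintype J]
    (a : I → EuclideanSpace ℝ (Fin n)) (b : J → EuclideanSpace ℝ (Fin n)) :
    ∃ (k : ℕ) (C : Fin k → Set (EuclideanSpace ℝ (Fin n))),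
      (∀ m, IsClosed (C m) ∧ Convex ℝ (C m) ∧ (interior (C m)).Nonempty) ∧
      closure ((⋂ i, (fun w => w - a i) '' interior W) ∩
          (⋂ j, (fun w => w - b j) '' Wᶜ)) = ⋃ m, C m := by
  obtain ⟨k, Q, hQ, rfl⟩ := hWpoly
  refine GoodSet.conclusion (GoodSet.inter ?_ ?_)
  · exact GoodSet.iInter fun i => (goodSet_interior_iUnion (fun m => (hQ m).facts.1)
      (fun m => (hQ m).facts.2.1)).translate (a i)
  · refine GoodSet.iInter fun j => GoodSet.translate ?_ (b j)
    rw [Set.compl_iUnion]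
    exact GoodSet.iInter fun m => (hQ m).facts.2.2
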